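/- Let d ≥ 1. The spectral zeta function of the Laplacian on the torus ℝ^d/(2πℤ^d), given for Re(s) > d/2 by ζ_{Δ_d}(s) = Σ_{n∈ℤ^d∖{0}} |n|^{−2s} (|n| the euclidean norm, the nonzero Laplace eigenvalues being |n|², n ∈ ℤ^d∖{0}), extends meromorphically to ℂ with a single, simple pole: there exists an entire function g : ℂ → ℂ such that for all Re(s) > d/2, Σ_{n∈ℤ^d∖{0}} |n|^{−2s} = g(s) + (π^{d/2}/Γ(d/2)) · 1/(s − d/2); in particular the pole is at s = d/2 with residue π^{d/2}/Γ(d/2). -/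

import Mathlib

open MeasureTheory Filter Finset Complex Metric
open scoped Topology Real

noncomputable section

/-- The vector of `ℝ^d` with integer coordinates `n ∈ ℤ^d`. -/
noncomputable def intVec {d : ℕ} (n : Fin d → ℤ) : EuclideanSpace ℝ (Fin d) :=
  (EuclideanSpace.equiv (Fin d) ℝ).symm fun i => (n i : ℝ)

open HurwitzZeta

/-- A finite power of a convergent series of nonnegative terms, expanded over tuples. -/
lemma hasSum_prod_pi_of_nonneg {ι : Type*} {f : ι → ℝ} {a : ℝ} (hf : HasSum f a)
    (h0 : ∀ i, 0 ≤ f i) (d : ℕ) :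
    HasSum (fun n : Fin d → ι ↦ ∏ i, f (n i)) (a ^ d) := by
  induction d with
  | zero => simp
  | succ d ih =>
    rw [← (Fin.consEquiv fun _ : Fin (d + 1) ↦ ι).hasSum_iff, pow_succ']
    have hs := hf.summable.mul_of_nonneg ih.summable h0
      fun n ↦ Finset.prod_nonneg fun i _ ↦ h0 (n i)
    refine (hf.mul ih hs).congr_fun fun x ↦ ?_
    simp [Fin.consEquiv, Fin.prod_univ_succ]

lemma norm_intVec_sq {d : ℕ} (n : Fin d → ℤ) : ‖intVec n‖ ^ 2 = ∑ i, (n i : ℝ) ^ 2 := by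
  simp [intVec, EuclideanSpace.norm_sq_eq]

@[simp]
lemma intVec_eq_zero {d : ℕ} {n : Fin d → ℤ} : intVec n = 0 ↔ n = 0 := by
  simp [intVec, funext_iff]

lemma intVec_injective {d : ℕ} : Function.Injective (intVec (d := d)) := by
  intro m n h
  have h' := (EuclideanSpace.equiv (Fin d) ℝ).symm.injective h
  ext i
  exact_mod_cast congr_fun h' i

lemma summable_norm_intVec_rpow {d : ℕ} {r : ℝ} (hr : r < -d) :
    Summable fun n : Fin d → ℤ ↦ ‖intVec n‖ ^ r := by
  let b := (EuclideanSpace.basisFun (Fin d) ℝ).toBasis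
  let L := Submodule.span ℤ (Set.range b)
  have hmem (n : Fin d → ℤ) : intVec n ∈ L := by
    refine (b.mem_span_iff_repr_mem ℤ _).mpr fun i ↦ ⟨n i, ?_⟩
    simp [b, intVec]
  have hrank : Module.finrank ℤ L = d := by
    rw [ZLattice.rank ℝ L, finrank_euclideanSpace_fin]
  have hL := ZLattice.summable_norm_rpow L r (by rwa [hrank])
  exact hL.comp_injective (i := fun n : Fin d → ℤ ↦ (⟨intVec n, hmem n⟩ : L))
    fun m n h ↦ intVec_injective (Subtype.ext_iff.mp h)

lemma hasSum_exp_neg_norm_intVec_sq (d : ℕ) {t : ℝ} (ht : 0 < t) :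
    HasSum (fun n : Fin d → ℤ ↦ Real.exp (-π * ‖intVec n‖ ^ 2 * t)) (evenKernel 0 t ^ d) := by
  have h := hasSum_int_evenKernel 0 ht
  simp only [add_zero, QuotientAddGroup.mk_zero] at h
  refine (hasSum_prod_pi_of_nonneg h (fun _ ↦ (Real.exp_pos _).le) d).congr_fun fun n ↦ ?_
  rw [norm_intVec_sq, ← Real.exp_sum, Finset.mul_sum, Finset.sum_mul]

lemma latticeTheta_isBigO (d : ℕ) (r : ℝ) :
    (fun t ↦ (evenKernel 0 t : ℂ) ^ d - 1) =O[atTop] (fun t ↦ t ^ r) := by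
  have h1 (r : ℝ) : (fun t ↦ (evenKernel 0 t : ℂ) - 1) =O[atTop] (fun t : ℝ ↦ t ^ r) := by
    simpa [hurwitzEvenFEPair] using (hurwitzEvenFEPair 0).hf_top r
  have hb : (fun t ↦ (evenKernel 0 t : ℂ)) =O[atTop] (fun _ : ℝ ↦ (1 : ℝ)) := by
    have h0 : (fun t ↦ (evenKernel 0 t : ℂ) - 1) =O[atTop] (fun _ : ℝ ↦ (1 : ℝ)) := by
      simpa using h1 0
    simpa using h0.add (Asymptotics.isBigO_const_const (1 : ℂ) one_ne_zero atTop)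
  induction d with
  | zero => simpa using Asymptotics.isBigO_zero _ _
  | succ d ih =>
    have h2 := (hb.mul ih).add (by simpa using h1 r)
    refine (h2.congr_left fun t ↦ ?_).trans (by simpa using Asymptotics.isBigO_refl _ _)
    ring

/-- The theta function of `ℤ^d` satisfies a functional equation of weight `d / 2`. -/
def latticeThetaFEPair (d : ℕ) (hd : 1 ≤ d) : WeakFEPair ℂ where
  f t := (evenKernel 0 t : ℂ) ^ d
  g t := (evenKernel 0 t : ℂ) ^ d
  k := d / 2
  ε := 1
  f₀ := 1
  g₀ := 1
  hf_int := ((continuous_ofReal.comp_continuousOn (continuousOn_evenKernel 0)).pow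
    d).locallyIntegrableOn measurableSet_Ioi
  hg_int := ((continuous_ofReal.comp_continuousOn (continuousOn_evenKernel 0)).pow
    d).locallyIntegrableOn measurableSet_Ioi
  hk := by positivity
  hε := one_ne_zero
  h_feq x (hx : 0 < x) := by
    have h : evenKernel 0 (1 / x) = x ^ (1 / 2 : ℝ) * evenKernel 0 x := by
      rw [evenKernel_functional_equation, ← evenKernel_eq_cosKernel_of_zero, one_div_one_div,
        one_div x, Real.inv_rpow hx.le, one_div, inv_inv]
    rw [h, one_mul, smul_eq_mul, ofReal_mul, mul_pow, ← ofReal_pow, ← Real.rpow_mul_natCast hx.le]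
    rw [one_div_mul_eq_div]
  hf_top := latticeTheta_isBigO d
  hg_top := latticeTheta_isBigO d

lemma hasSum_latticeTheta_mellin {d : ℕ} (hd : 1 ≤ d) {s : ℂ} (hs : (d : ℝ) / 2 < s.re) :
    HasSum (fun n : Fin d → ℤ ↦ (π : ℂ) ^ (-s) * Gamma s * ((‖intVec n‖ : ℝ) : ℂ) ^ (-2 * s))
      ((latticeThetaFEPair d hd).Λ s) := by
  have hs0 : 0 < s.re := lt_of_le_of_lt (by positivity) hs
  rw [← ((latticeThetaFEPair d hd).hasMellin hs).2]
  refine (hasSum_mellin_pi_mul₀ (a := fun _ ↦ 1) (p := fun n : Fin d → ℤ ↦ ‖intVec n‖ ^ 2)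
    (fun _ ↦ sq_nonneg _) hs0 (fun t ht ↦ ?_) ?_).congr_fun fun n ↦ ?_
  · have h := hasSum_ite_sub_hasSum (hasSum_ofReal.mpr (hasSum_exp_neg_norm_intVec_sq d ht)) 0
    have h0 : intVec (0 : Fin d → ℤ) = 0 := by simp
    simpa [latticeThetaFEPair, h0] using h
  · refine (summable_norm_intVec_rpow (d := d) (r := -(2 * s.re)) (by linarith)).congr fun n ↦ ?_
    rw [norm_one, one_div, Real.rpow_neg (norm_nonneg _), ← Real.rpow_natCast_mul (norm_nonneg _)]
    norm_num
  · rw [mul_one, div_eq_mul_inv, ← cpow_neg, ofReal_pow, ← cpow_nat_mul']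
    · congr 2
      push_cast
      ring
    all_goals
      rw [arg_ofReal_of_nonneg (norm_nonneg _)]
      linarith [Real.pi_pos]

/-- **Meromorphic continuation of the spectral zeta function of the Laplacian on the torus
`ℝ^d/(2πℤ^d)`:** there is an entire function `g` with
`ζ_{Δ_d}(s) = Σ_{n∈ℤ^d∖{0}} |n|^{−2s} = g(s) + (π^{d/2}/Γ(d/2))·1/(s−d/2)` for `Re(s) > d/2`;
in particular the only pole is simple, at `s = d/2`, with residue `π^{d/2}/Γ(d/2)`. -/
theorem torus_laplacian_zeta_meromorphic_continuation {d : ℕ} (hd : 1 ≤ d) :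
    ∃ g : ℂ → ℂ, Differentiable ℂ g ∧
      ∀ s : ℂ, (d : ℝ) / 2 < s.re →
        ∑' n : {n : Fin d → ℤ // n ≠ 0}, ((‖intVec n.1‖ : ℝ) : ℂ) ^ (-2 * s)
          = g s + ((Real.pi ^ ((d : ℝ) / 2) / Real.Gamma ((d : ℝ) / 2) : ℝ) : ℂ) *
              (1 / (s - (d : ℂ) / 2)) := by
  set h : ℂ → ℂ := fun s ↦ (π : ℂ) ^ s * (Gamma s)⁻¹
  have hπ : (π : ℂ) ≠ 0 := ofReal_ne_zero.mpr Real.pi_ne_zero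
  have hpow : Differentiable ℂ fun s : ℂ ↦ (π : ℂ) ^ s :=
    differentiable_id.const_cpow (.inl hπ)
  have hh : Differentiable ℂ h := hpow.mul differentiable_one_div_Gamma
  have hslope : Differentiable ℂ (dslope h (d / 2)) := by
    rw [← differentiableOn_univ, differentiableOn_dslope univ_mem]
    exact hh.differentiableOn
  have hc : h (d / 2) = ((π ^ ((d : ℝ) / 2) / Real.Gamma ((d : ℝ) / 2) : ℝ) : ℂ) := by
    simp only [h]
    rw [ofReal_div, ofReal_cpow Real.pi_pos.le, ← Gamma_ofReal, div_eq_mul_inv]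
    push_cast
    rfl
  let P := latticeThetaFEPair d hd
  refine ⟨fun s ↦ h s * P.Λ₀ s - (π : ℂ) ^ s * (Gamma (s + 1))⁻¹ + dslope h (d / 2) s, ?_, ?_⟩
  · exact ((hh.mul P.differentiable_Λ₀).sub
      (hpow.mul (differentiable_one_div_Gamma.comp (differentiable_id.add_const 1)))).add hslope
  intro s hs
  have hs0 : 0 < s.re := lt_of_le_of_lt (by positivity) hs
  have hs' : s ≠ 0 := by rintro rfl; simp at hs0
  have hsd : s ≠ d / 2 := by
    rintro rfl
    simp at hs
  have hsd' : s - d / 2 ≠ 0 := sub_ne_zero.mpr hsd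
  have hΓ : Gamma s ≠ 0 := Gamma_ne_zero_of_re_pos hs0
  have hπs : (π : ℂ) ^ s ≠ 0 := by simp [cpow_eq_zero_iff, hπ]
  have hsum : ∑' n : Fin d → ℤ, ((‖intVec n‖ : ℝ) : ℂ) ^ (-2 * s) = h s * P.Λ s := by
    rw [← (hasSum_latticeTheta_mellin hd hs).tsum_eq, tsum_mul_left, cpow_neg]
    simp only [h]
    field_simp
  have hsub : ∑' n : {n : Fin d → ℤ // n ≠ 0}, ((‖intVec n.1‖ : ℝ) : ℂ) ^ (-2 * s) =
      ∑' n : Fin d → ℤ, ((‖intVec n‖ : ℝ) : ℂ) ^ (-2 * s) := by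
    refine tsum_subtype_eq_of_support_subset (s := {n : Fin d → ℤ | n ≠ 0})
      (f := fun n ↦ ((‖intVec n‖ : ℝ) : ℂ) ^ (-2 * s)) fun n hn h0 ↦ hn ?_
    simp [intVec_eq_zero.mpr h0, hs']
  have hΛ : P.Λ₀ s = P.Λ s + 1 / s + 1 / ((d : ℂ) / 2 - s) := by
    simpa [P, latticeThetaFEPair] using P.Λ₀_eq s
  beta_reduce
  rw [hsub, hsum, dslope_of_ne _ hsd, slope_def_field, ← hc, hΛ, Gamma_add_one s hs']
  generalize h (d / 2) = c
  simp only [h]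
  rw [← neg_sub s ((d : ℂ) / 2)]
  generalize s - (d : ℂ) / 2 = w at *
  field_simp
  ring
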